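/- Let a be a base sequence and let I be an ideal of subsets of ℕ that is an F_σ subset of 2^ℕ (with the product topology). Then the set H = { r ∈ ℝ : j_a(|r|) ∈ I } is an F_σ subset of ℝ, i.e., a countable union of closed subsets of ℝ. -/

import Mathlib

open Set Filter
open scoped ENNReal

/-- `a₀ a₁ ⋯ a_{n-1}` as a real number: the product of the first `n` terms of the
base sequence (the paper's `a₁ ⋯ a_n`, re-indexed from 0). -/
noncomputable def bProd (a : ℕ → ℕ) (n : ℕ) : ℝ := ∏ k ∈ Finset.range n, (a k : ℝ)

/-- The `n`-th digit (0-indexed; the paper's `(n+1)`-st digit) of the nonnegative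
real `r` in base `a`:  `r_n = ⌊a₁⋯a_n (r - ⌊r⌋)⌋ - a_n ⌊a₁⋯a_{n-1} (r - ⌊r⌋)⌋`. -/
noncomputable def digit (a : ℕ → ℕ) (r : ℝ) (n : ℕ) : ℤ :=
  ⌊bProd a (n + 1) * Int.fract r⌋ - (a n : ℤ) * ⌊bProd a n * Int.fract r⌋

/-- `j_a(r) = { n : r_n ≠ r_{n+1} }`. -/
def jSet (a : ℕ → ℕ) (r : ℝ) : Set ℕ := {n | digit a r n ≠ digit a r (n + 1)}

/-- An ideal of subsets of ℕ: closed under subsets and finite unions, containing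
all singletons (hence nonempty). -/
def IsIdeal (I : Set (Set ℕ)) : Prop :=
  (∀ ⦃x y : Set ℕ⦄, x ∈ I → y ⊆ x → y ∈ I) ∧
  (∀ ⦃x y : Set ℕ⦄, x ∈ I → y ∈ I → x ∪ y ∈ I) ∧
  (∀ n : ℕ, ({n} : Set ℕ) ∈ I)

/-- Translation invariance of a family of subsets of ℕ. -/
def TransInv (I : Set (Set ℕ)) : Prop :=
  ∀ x ∈ I, ({n | ∃ m ∈ x, n = m + 1} ∈ I) ∧ ({n | n + 1 ∈ x} ∈ I)

/-- A tall family: every infinite set of naturals has an infinite subset in the family. -/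
def TallIdeal (I : Set (Set ℕ)) : Prop :=
  ∀ x : Set ℕ, x.Infinite → ∃ y, y ⊆ x ∧ y.Infinite ∧ y ∈ I

/-- The base sequence `a` is adapted to `I` if `{n : a_n ≠ a_{n+1}} ∈ I`. -/
def AdaptedTo (a : ℕ → ℕ) (I : Set (Set ℕ)) : Prop := {n | a n ≠ a (n + 1)} ∈ I

/-- A lower semicontinuous submeasure on subsets of ℕ. -/
def IsLscSubmeasure (φ : Set ℕ → ℝ≥0∞) : Prop :=
  φ ∅ = 0 ∧
  (∀ ⦃x y : Set ℕ⦄, x ⊆ y → φ x ≤ φ y) ∧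
  (∀ x y : Set ℕ, φ (x ∪ y) ≤ φ x + φ y) ∧
  (∀ n : ℕ, 0 < φ {n} ∧ φ {n} < ⊤) ∧
  (∀ x : Set ℕ, φ x = ⨆ n : ℕ, φ (x ∩ {k | k < n}))

/-- `Exh(φ) = { x ⊆ ℕ : φ(x \ {0,…,n-1}) → 0 }`. -/
def Exh (φ : Set ℕ → ℝ≥0∞) : Set (Set ℕ) :=
  {x | Filter.Tendsto (fun n => φ (x \ {k | k < n})) Filter.atTop (nhds 0)}

/-- `pr(a)`: the set of primes dividing `a_n` for all but finitely many `n`. -/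
def prSet (a : ℕ → ℕ) : Set ℕ := {p | p.Prime ∧ ∀ᶠ n in Filter.atTop, p ∣ a n}

/-- A base sequence is uniform if every prime dividing some `a_n` divides `a_n`
for all but finitely many `n`. -/
def UniformBase (a : ℕ → ℕ) : Prop :=
  ∀ p : ℕ, p.Prime → (∃ n, p ∣ a n) → ∀ᶠ n in Filter.atTop, p ∣ a n

/-- `ℚ_a`, viewed as a set of real numbers: fractions `k/l` with every prime
divisor of `l` in `pr(a)`. -/
def Qa (a : ℕ → ℕ) : Set ℝ :=
  {r | ∃ (k : ℤ) (l : ℕ), 0 < l ∧ (∀ p : ℕ, p.Prime → p ∣ l → p ∈ prSet a) ∧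
    r = (k : ℝ) / (l : ℝ)}

/-- `H = { r ∈ ℝ : j_a(|r|) ∈ I }`. -/
def Hset (a : ℕ → ℕ) (I : Set (Set ℕ)) : Set ℝ := {r | jSet a |r| ∈ I}

/-- `ρ(r,s) = φ(j_a(|r-s|)) + |r-s|`. -/
noncomputable def rho (a : ℕ → ℕ) (φ : Set ℕ → ℝ≥0∞) (r s : ℝ) : ℝ :=
  (φ (jSet a |r - s|)).toReal + |r - s|

/-- `bProd a n` is an integer. -/
theorem exists_int_bProd (a : ℕ → ℕ) (n : ℕ) : ∃ m : ℤ, bProd a n = m :=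
  ⟨∏ k ∈ Finset.range n, (a k : ℤ), by simp [bProd]⟩

theorem bProd_succ (a : ℕ → ℕ) (n : ℕ) : bProd a (n + 1) = bProd a n * a n :=
  Finset.prod_range_succ _ _

/-- The reals whose absolute value has an expansion terminating before place `n`. -/
def terminatingAt (a : ℕ → ℕ) (n : ℕ) : Set ℝ :=
  {r | bProd a n * |r| ∈ Set.range ((↑) : ℤ → ℝ)}

theorem isClosed_terminatingAt (a : ℕ → ℕ) (n : ℕ) : IsClosed (terminatingAt a n) :=
  Int.isClosedEmbedding_coe_real.isClosed_range.preimage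
    (continuous_const.mul continuous_abs)

theorem bProd_mul_fract_mem_range_iff (a : ℕ → ℕ) (n : ℕ) (r : ℝ) :
    bProd a n * Int.fract r ∈ Set.range ((↑) : ℤ → ℝ) ↔
      bProd a n * r ∈ Set.range ((↑) : ℤ → ℝ) := by
  obtain ⟨b, hb⟩ := exists_int_bProd a n
  rw [hb]
  constructor
  · rintro ⟨m, hm⟩
    refine ⟨m + b * ⌊r⌋, ?_⟩
    push_cast
    rw [hm, Int.fract]
    ring
  · rintro ⟨m, hm⟩
    refine ⟨m - b * ⌊r⌋, ?_⟩
    push_cast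
    rw [hm, Int.fract]
    ring

theorem digit_eq_zero_of_integral {a : ℕ → ℕ} {r : ℝ} {n : ℕ}
    (h : bProd a n * Int.fract r ∈ Set.range ((↑) : ℤ → ℝ)) : digit a r n = 0 := by
  obtain ⟨m, hm⟩ := h
  have h' : bProd a (n + 1) * Int.fract r = ((a n * m : ℤ) : ℝ) := by
    rw [bProd_succ]
    push_cast
    rw [hm]
    ring
  rw [digit, h', ← hm, Int.floor_intCast, Int.floor_intCast, sub_self]

theorem integral_bProd_mul_of_le {a : ℕ → ℕ} {x : ℝ} {n k : ℕ} (hnk : n ≤ k)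
    (h : bProd a n * x ∈ Set.range ((↑) : ℤ → ℝ)) :
    bProd a k * x ∈ Set.range ((↑) : ℤ → ℝ) := by
  induction k, hnk using Nat.le_induction with
  | base => exact h
  | succ k _ ih =>
    obtain ⟨m, hm⟩ := ih
    refine ⟨m * a k, ?_⟩
    rw [bProd_succ]
    push_cast
    rw [hm]
    ring

theorem jSet_subset_of_mem_terminatingAt {a : ℕ → ℕ} {r : ℝ} {n : ℕ}
    (h : r ∈ terminatingAt a n) : jSet a |r| ⊆ {k | k < n} := by
  intro k hk
  by_contra hkn
  have hn : n ≤ k := not_lt.mp hkn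
  have h' := (bProd_mul_fract_mem_range_iff a n |r|).2 h
  exact hk ((digit_eq_zero_of_integral (integral_bProd_mul_of_le hn h')).trans
    (digit_eq_zero_of_integral (integral_bProd_mul_of_le (hn.trans k.le_succ) h')).symm)

theorem IsIdeal.initial_segment_mem {I : Set (Set ℕ)} (hI : IsIdeal I) (n : ℕ) :
    {k | k < n} ∈ I := by
  induction n with
  | zero => exact hI.1 (hI.2.2 0) (by simp)
  | succ n ih =>
    refine hI.1 (hI.2.1 ih (hI.2.2 n)) fun k hk => ?_
    exact Nat.lt_succ_iff_lt_or_eq.1 hk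

/-- A function continuous at a point with non-integral value there has locally constant floor. -/
theorem ContinuousAt.eventually_floor_eq {f : ℝ → ℝ} {r : ℝ} (hf : ContinuousAt f r)
    (h : f r ∉ Set.range ((↑) : ℤ → ℝ)) : ∀ᶠ s in nhds r, ⌊f s⌋ = ⌊f r⌋ := by
  have hlt : (⌊f r⌋ : ℝ) < f r := lt_of_le_of_ne (Int.floor_le _) fun e => h ⟨_, e⟩
  filter_upwards [hf.eventually (Ioo_mem_nhds hlt (Int.lt_floor_add_one _))] with s hs
  exact Int.floor_eq_iff.2 ⟨hs.1.le, hs.2⟩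

theorem eventually_digit_abs_eq {a : ℕ → ℕ} {r : ℝ} (h : ∀ n, r ∉ terminatingAt a n) (n : ℕ) :
    ∀ᶠ s in nhds r, digit a |s| n = digit a |r| n := by
  have hr : |r| ∉ Set.range ((↑) : ℤ → ℝ) := by simpa [terminatingAt, bProd] using h 0
  have hfract : ContinuousAt (fun s : ℝ => Int.fract |s|) r := by
    have hfloor := continuous_abs.continuousAt.eventually_floor_eq hr
    refine (continuous_abs.continuousAt.sub
      (continuousAt_const (y := ((⌊|r|⌋ : ℤ) : ℝ)))).congr ?_
    filter_upwards [hfloor] with s hs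
    simp only [Int.fract, hs, Pi.sub_apply]
  have key (m : ℕ) := (hfract.const_mul (bProd a m)).eventually_floor_eq
    (mt (bProd_mul_fract_mem_range_iff a m |r|).1 (h m))
  filter_upwards [key n, key (n + 1)] with s h₁ h₂
  rw [digit, digit, h₁, h₂]

open Classical in
/-- The characteristic function of `jSet a |r|`. -/
noncomputable def jChar (a : ℕ → ℕ) (r : ℝ) : ℕ → Bool := fun n => decide (n ∈ jSet a |r|)

theorem setOf_jChar_eq_true (a : ℕ → ℕ) (r : ℝ) : {n | jChar a r n = true} = jSet a |r| := by
  simp [jChar]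

theorem continuousAt_jChar {a : ℕ → ℕ} {r : ℝ} (h : ∀ n, r ∉ terminatingAt a n) :
    ContinuousAt (jChar a) r := by
  refine continuousAt_pi.2 fun n => continuousAt_const.congr (f := fun _ => jChar a r n) ?_
  filter_upwards [eventually_digit_abs_eq h n, eventually_digit_abs_eq h (n + 1)] with s h₁ h₂
  refine decide_eq_decide.2 ?_
  simp only [jSet, Set.mem_ofPred_eq, h₁, h₂]

/-- Lemma 2.8: if `I` is Fσ in `2^ℕ`, then `H` is Fσ in ℝ.
Here `2^ℕ` is encoded as `ℕ → Bool` with the product topology. -/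
theorem Hset_Fsigma (a : ℕ → ℕ) (ha : ∀ n, 2 ≤ a n)
    (I : Set (Set ℕ)) (hI : IsIdeal I)
    (hFσ : ∃ C : ℕ → Set (ℕ → Bool), (∀ k, IsClosed (C k)) ∧
      {f : ℕ → Bool | {n | f n = true} ∈ I} = ⋃ k, C k) :
    ∃ F : ℕ → Set ℝ, (∀ k, IsClosed (F k)) ∧ Hset a I = ⋃ k, F k := by
  obtain ⟨C, hC, hIC⟩ := hFσ
  have hmem (r : ℝ) : r ∈ Hset a I ↔ ∃ k, jChar a r ∈ C k := by
    rw [← Set.mem_iUnion, ← hIC, Set.mem_ofPred_eq, setOf_jChar_eq_true]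
    rfl
  refine ⟨fun k => closure (jChar a ⁻¹' C k) ∪ terminatingAt a k,
    fun k => isClosed_closure.union (isClosed_terminatingAt a k), Set.ext fun r => ?_⟩
  rw [Set.mem_iUnion]
  constructor
  · intro hr
    obtain ⟨k, hk⟩ := (hmem r).1 hr
    exact ⟨k, Or.inl (subset_closure hk)⟩
  · rintro ⟨k, hk⟩
    by_cases hD : ∃ n, r ∈ terminatingAt a n
    · obtain ⟨n, hn⟩ := hD
      exact hI.1 (hI.initial_segment_mem n) (jSet_subset_of_mem_terminatingAt hn)
    · have hD' := not_exists.1 hD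
      have hcl := hk.resolve_right (hD' k)
      refine (hmem r).2 ⟨k, (hC k).closure_subset ?_⟩
      exact closure_mono (Set.image_preimage_subset _ _)
        (mem_closure_image (continuousAt_jChar hD') hcl)
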